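/- For every ℓ ≥ 1 there exists n ∈ ℕ such that: for every coset n-acyclic Cayley group G with generator set E, all vertices v ≠ u in G, every γ ⊆ E, and t = ρ(v,γ): d_t(v,u) = ℓ if and only if d_t(⟦v⟧, ⟦u⟧) = ℓ − 1. -/

import Mathlib

open scoped Pointwise

section CayleyDefs

variable {G : Type*} [Group G]

/-- The `α`-coset of `v`, i.e. `v · ⟨α⟩` where `⟨α⟩` is the subgroup generated by `α`. -/
def coset (v : G) (α : Set G) : Set G := {x | v⁻¹ * x ∈ Subgroup.closure α}

/-- `G` together with the generator set `E` is a Cayley group: every element of `E`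
is a non-trivial involution and `E` generates `G`. -/
def IsCayley (E : Set G) : Prop :=
  (∀ e ∈ E, e ≠ 1 ∧ e * e = 1) ∧ Subgroup.closure E = ⊤

/-- A coset cycle of length `m` in the Cayley group `G` with generator set `E`. -/
def IsCosetCycle (E : Set G) (m : ℕ) (v : ZMod m → G) (α : ZMod m → Set G) : Prop :=
  (∀ i, α i ⊆ E) ∧
  (∀ i, (v i)⁻¹ * v (i + 1) ∈ Subgroup.closure (α i)) ∧
  (∀ i, coset (v i) (α (i - 1) ∩ α i) ∩ coset (v (i + 1)) (α i ∩ α (i + 1)) = ∅)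

/-- Coset `n`-acyclic: no coset cycle of length `≤ n`. -/
def CosetAcyclic (E : Set G) (n : ℕ) : Prop :=
  ∀ m, 1 ≤ m → m ≤ n → ∀ (v : ZMod m → G) (α : ZMod m → Set G), ¬ IsCosetCycle E m v α

/-- 2-acyclic: no coset cycle of length 2. -/
def TwoAcyclic (E : Set G) : Prop :=
  ∀ (v : ZMod 2 → G) (α : ZMod 2 → Set G), ¬ IsCosetCycle E 2 v α

/-- Labels of a path of length `ℓ`, where labels with indices outside `1..ℓ` equal `∅`. -/
def extLabel (ℓ : ℕ) (α : ℕ → Set G) (i : ℕ) : Set G :=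
  if 1 ≤ i ∧ i ≤ ℓ then α i else ∅

/-- A coset path of length `ℓ ≥ 1` with vertices `v 1, …, v (ℓ+1)` and labels
`α 1, …, α ℓ` (vertices pairwise distinct except possibly `v 1 = v (ℓ+1)`;
convention `α 0 = α (ℓ+1) = ∅`). -/
def IsCosetPath (E : Set G) (ℓ : ℕ) (v : ℕ → G) (α : ℕ → Set G) : Prop :=
  1 ≤ ℓ ∧
  (∀ i, 1 ≤ i → i ≤ ℓ → α i ⊆ E) ∧
  (∀ i j, 1 ≤ i → i < j → j ≤ ℓ + 1 → v i = v j → i = 1 ∧ j = ℓ + 1) ∧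
  (∀ i, 1 ≤ i → i ≤ ℓ → (v i)⁻¹ * v (i + 1) ∈ Subgroup.closure (α i)) ∧
  (∀ i, 1 ≤ i → i ≤ ℓ →
    coset (v i) (extLabel ℓ α (i - 1) ∩ α i) ∩
      coset (v (i + 1)) (α i ∩ extLabel ℓ α (i + 1)) = ∅)

/-- `γ` is the unique minimal generator set connecting `v` and `u`:
for every `β ⊆ E`, `u ∈ [v]_β` iff `γ ⊆ β`. -/
def IsGen (E : Set G) (v u : G) (γ : Set G) : Prop :=
  γ ⊆ E ∧ ∀ β ⊆ E, (u ∈ coset v β ↔ γ ⊆ β)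

/-- The dual hyperedge `⟦v⟧`: all label-tagged cosets `(α, [v]_α)` for `α ⊆ E`. -/
def dedge (E : Set G) (v : G) : Set (Set G × Set G) :=
  {p | p.1 ⊆ E ∧ p.2 = coset v p.1}

/-- The vertex set of the dual hypergraph: all label-tagged cosets. -/
def dualV (E : Set G) : Set (Set G × Set G) :=
  {p | p.1 ⊆ E ∧ ∃ v : G, p.2 = coset v p.1}

/-- Gaifman adjacency in the dual hypergraph: two distinct vertices lying in a
common hyperedge. -/
def dAdj (E : Set G) (x y : Set G × Set G) : Prop :=
  x ≠ y ∧ ∃ w : G, x ∈ dedge E w ∧ y ∈ dedge E w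

/-- `ρ(v,γ) = { (β, [v]_β) : γ ⊆ β ⊆ E }`. -/
def rho (E : Set G) (v : G) (γ : Set G) : Set (Set G × Set G) :=
  {p | γ ⊆ p.1 ∧ p.1 ⊆ E ∧ p.2 = coset v p.1}

/-- A non-`t` coset path for `t = ρ(w,γ)`: a coset path all of whose links `[v_i]_{α_i}`
fail to contain `[w]_γ`. -/
def IsNonTPath (E : Set G) (w : G) (γ : Set G) (ℓ : ℕ) (v : ℕ → G) (α : ℕ → Set G) : Prop :=
  IsCosetPath E ℓ v α ∧ ∀ i, 1 ≤ i → i ≤ ℓ → ¬ coset w γ ⊆ coset (v i) (α i)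

/-- An inner coset path with respect to `g = gen(v 1, v (ℓ+1))`. -/
def IsInnerPath (E : Set G) (g : Set G) (ℓ : ℕ) (v : ℕ → G) (α : ℕ → Set G) : Prop :=
  IsCosetPath E ℓ v α ∧ 2 ≤ ℓ ∧
    ∀ i, 1 ≤ i → i ≤ ℓ → coset (v i) (α i) ⊂ coset (v 1) g

/-- A non-trivial coset path with respect to `g = gen(v 1, v (ℓ+1))`. -/
def IsNontrivialPath (E : Set G) (g : Set G) (ℓ : ℕ) (v : ℕ → G) (α : ℕ → Set G) : Prop :=
  IsCosetPath E ℓ v α ∧ 2 ≤ ℓ ∧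
    ∀ i, 1 ≤ i → i ≤ ℓ → ¬ coset (v 1) g ⊆ coset (v i) (α i)

/-- `n`-conformality of the dual hypergraph: every Gaifman clique of size `≤ n`
is contained in a hyperedge. -/
def NConformal (E : Set G) (n : ℕ) : Prop :=
  ∀ K : Finset (Set G × Set G), K.card ≤ n → (↑K : Set (Set G × Set G)) ⊆ dualV E →
    (∀ x ∈ K, ∀ y ∈ K, x ≠ y → dAdj E x y) → ∃ w : G, ∀ x ∈ K, x ∈ dedge E w

/-- `n`-chordality of the dual hypergraph: every Gaifman cycle of length `> 3`
and `≤ n` has a chord. -/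
def NChordal (E : Set G) (n : ℕ) : Prop :=
  ∀ m, 4 ≤ m → m ≤ n → ∀ c : ZMod m → Set G × Set G, Function.Injective c →
    (∀ i, c i ∈ dualV E) → (∀ i, dAdj E (c i) (c (i + 1))) →
    ∃ i j : ZMod m, i ≠ j ∧ j ≠ i + 1 ∧ i ≠ j + 1 ∧ dAdj E (c i) (c j)

/-- A walk of length `k` in the Gaifman graph of the dual hypergraph restricted to
the complement of `t = ρ(v,γ)`, from a vertex of `⟦v⟧ \ t` to a vertex of `⟦u⟧ \ t`. -/
def HWalk (E : Set G) (v : G) (γ : Set G) (u : G) (k : ℕ) (c : ℕ → Set G × Set G) : Prop :=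
  c 0 ∈ dedge E v ∧ c k ∈ dedge E u ∧
  (∀ i ≤ k, c i ∈ dualV E ∧ c i ∉ rho E v γ) ∧
  ∀ i < k, dAdj E (c i) (c (i + 1))

/-- The sequence of dual-hypergraph vertices induced by a coset path:
`(∅,[v 1]_∅), (α 1, [v 2]_{α 1}), …, (α ℓ, [v (ℓ+1)]_{α ℓ}), (∅, [v (ℓ+1)]_∅)`. -/
def pathVert (ℓ : ℕ) (v : ℕ → G) (α : ℕ → Set G) (i : ℕ) : Set G × Set G :=
  if i = 0 then (∅, coset (v 1) ∅)
  else if i ≤ ℓ then (α i, coset (v (i + 1)) (α i))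
  else (∅, coset (v (ℓ + 1)) ∅)

end CayleyDefs


section RelChain

variable {X : Type*} {R : X → X → Prop}

/-- `x` and `y` are joined by a chain of `n` consecutive `R`-steps, indexed from `1` to `n + 1`. -/
def RelChain (R : X → X → Prop) (n : ℕ) (x y : X) : Prop :=
  ∃ f : ℕ → X, f 1 = x ∧ f (n + 1) = y ∧ ∀ i, 1 ≤ i → i ≤ n → R (f i) (f (i + 1))

theorem RelChain.segment {f : ℕ → X} {n : ℕ} (hf : ∀ i, 1 ≤ i → i ≤ n → R (f i) (f (i + 1)))
    {a b : ℕ} (ha : 1 ≤ a) (hab : a ≤ b) (hb : b ≤ n + 1) : RelChain R (b - a) (f a) (f b) := by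
  refine ⟨fun i => f (a + i - 1), by simp, ?_, fun i h1 h2 => ?_⟩
  · show f (a + (b - a + 1) - 1) = f b
    congr 1
    omega
  · have h := hf (a + i - 1) (by omega) (by omega)
    rwa [show a + i - 1 + 1 = a + (i + 1) - 1 by omega] at h

theorem RelChain.refl (x : X) : RelChain R 0 x x :=
  ⟨fun _ => x, rfl, rfl, fun i h1 h2 => by omega⟩

theorem RelChain.single {x y : X} (h : R x y) : RelChain R 1 x y := by
  refine ⟨fun i => if i = 1 then x else y, by simp, by simp, fun i h1 h2 => ?_⟩
  obtain rfl : i = 1 := by omega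
  simpa using h

theorem RelChain.append {m n : ℕ} {x y z : X} (hxy : RelChain R m x y) (hyz : RelChain R n y z) :
    RelChain R (m + n) x z := by
  obtain ⟨f, f1, fm, hf⟩ := hxy
  obtain ⟨g, g1, gn, hg⟩ := hyz
  refine ⟨fun i => if i ≤ m then f i else g (i - m), ?_, ?_, fun i h1 h2 => ?_⟩
  · by_cases hm : 1 ≤ m
    · simpa [hm] using f1
    · obtain rfl : m = 0 := by omega
      simpa [g1, ← fm] using f1
  · simpa [show ¬ m + n + 1 ≤ m by omega, show m + n + 1 - m = n + 1 by omega] using gn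
  · dsimp only
    rcases lt_trichotomy i m with h | rfl | h
    · rw [if_pos h.le, if_pos (by omega)]
      exact hf i h1 h.le
    · have h := hf i h1 le_rfl
      rw [fm, ← g1] at h
      simpa using h
    · rw [if_neg (by omega), if_neg (by omega), show i + 1 - m = i - m + 1 by omega]
      exact hg (i - m) (by omega) (by omega)

end RelChain

section Distances

variable {G : Type*} [Group G] {E : Set G}

theorem mem_coset_self (x : G) (α : Set G) : x ∈ coset x α := by
  simp [coset]

theorem coset_mono (x : G) {α β : Set G} (h : α ⊆ β) : coset x α ⊆ coset x β :=
  fun _ hy => Subgroup.closure_mono h hy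

theorem coset_empty (x : G) : coset x ∅ = {x} := by
  ext y
  simp [coset, inv_mul_eq_one, eq_comm]

theorem coset_eq_of_mem {x y : G} {α : Set G} (h : y ∈ coset x α) : coset x α = coset y α := by
  have h' : x⁻¹ * y ∈ Subgroup.closure α := h
  ext z
  show x⁻¹ * z ∈ Subgroup.closure α ↔ y⁻¹ * z ∈ Subgroup.closure α
  rw [← Subgroup.mul_mem_cancel_left _ h' (y := y⁻¹ * z)]
  simp [mul_assoc]

theorem CosetAcyclic.closure_inter {n : ℕ} (hn : 2 ≤ n) (h : CosetAcyclic E n) {α β : Set G}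
    (hα : α ⊆ E) (hβ : β ⊆ E) {g : G} (hgα : g ∈ Subgroup.closure α)
    (hgβ : g ∈ Subgroup.closure β) : g ∈ Subgroup.closure (α ∩ β) := by
  by_contra hg
  have key : ∀ x : G, x ∈ Subgroup.closure (α ∩ β) → g⁻¹ * x ∈ Subgroup.closure (α ∩ β) →
      False := fun x hx hgx => hg <| by simpa using mul_mem hx (inv_mem hgx)
  refine h 2 (by norm_num) hn ![1, g] ![α, β] ⟨?_, ?_, ?_⟩
  · exact Fin.forall_fin_two.2 ⟨hα, hβ⟩
  · refine Fin.forall_fin_two.2 ⟨?_, ?_⟩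
    · show (1 : G)⁻¹ * g ∈ Subgroup.closure α
      simpa using hgα
    · show g⁻¹ * 1 ∈ Subgroup.closure β
      simpa using hgβ
  · refine Fin.forall_fin_two.2 ⟨?_, ?_⟩
    · show coset 1 (β ∩ α) ∩ coset g (α ∩ β) = ∅
      rw [Set.inter_comm β α]
      refine Set.eq_empty_of_forall_notMem fun x hx => key x ?_ hx.2
      simpa [coset] using hx.1
    · show coset g (α ∩ β) ∩ coset 1 (β ∩ α) = ∅
      rw [Set.inter_comm β α]
      refine Set.eq_empty_of_forall_notMem fun x hx => key x ?_ hx.1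
      simpa [coset] using hx.2

theorem subset_of_coset_subset {n : ℕ} (hE : IsCayley E) (hn : 2 ≤ n) (h : CosetAcyclic E n)
    {α γ : Set G} (hα : α ⊆ E) (hγ : γ ⊆ E) {x : G} (hsub : coset x γ ⊆ coset x α) : γ ⊆ α := by
  intro e he
  have heα : e ∈ Subgroup.closure α := by
    have : x * e ∈ coset x α := hsub (by simpa [coset] using Subgroup.subset_closure he)
    simpa [coset] using this
  have hmem := h.closure_inter hn hα (Set.singleton_subset_iff.2 (hγ he)) heα
    (Subgroup.subset_closure (Set.mem_singleton e))
  by_contra hne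
  rw [Set.inter_singleton_eq_empty.2 hne, Subgroup.closure_empty, Subgroup.mem_bot] at hmem
  exact (hE.1 e (hγ he)).1 hmem

/-- A coset path with links avoiding `[w]_γ` yields a walk in the dual hypergraph outside
`ρ(w, γ)` that is one step shorter. -/
theorem IsNonTPath.exists_hWalk {w : G} {γ : Set G} {k : ℕ} {vs : ℕ → G} {α : ℕ → Set G}
    (hp : IsNonTPath E w γ k vs α) (hw : vs 1 = w) :
    ∃ c, HWalk E w γ (vs (k + 1)) (k - 1) c := by
  obtain ⟨⟨hk, hα, -, hlink, hdisj⟩, ht⟩ := hp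
  have hend : ∀ i, 1 ≤ i → i ≤ k → coset (vs i) (α i) = coset (vs (i + 1)) (α i) :=
    fun i h1 h2 => coset_eq_of_mem (hlink i h1 h2)
  refine ⟨fun i => (α (i + 1), coset (vs (i + 1)) (α (i + 1))), ?_, ?_, fun i hi => ⟨?_, ?_⟩,
    fun i hi => ⟨fun heq => ?_, vs (i + 2), ?_, ?_⟩⟩
  · exact ⟨hα 1 le_rfl hk, by rw [← hw]⟩
  · dsimp only
    rw [Nat.sub_add_cancel hk]
    exact ⟨hα k hk le_rfl, hend k hk le_rfl⟩
  · exact ⟨hα _ (by omega) (by omega), _, rfl⟩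
  · rintro ⟨hγ, -, heq⟩
    refine ht (i + 1) (by omega) (by omega) ?_
    dsimp only at hγ heq
    rw [heq]
    exact coset_mono w hγ
  · have hαeq : α (i + 1) = α (i + 2) := congrArg Prod.fst heq
    have hd := hdisj (i + 1) (by omega) (by omega)
    have hext : extLabel k α (i + 1 + 1) = α (i + 1) := by
      rw [extLabel, if_pos (by omega), hαeq]
    rw [hext, Set.inter_self, ← hend (i + 1) (by omega) (by omega)] at hd
    exact Set.eq_empty_iff_forall_notMem.1 hd (vs (i + 1)) ⟨mem_coset_self _ _, mem_coset_self _ _⟩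
  · exact ⟨hα _ (by omega) (by omega), hend (i + 1) (by omega) (by omega)⟩
  · exact ⟨hα _ (by omega) (by omega), rfl⟩

/-- `x` and `y` lie in a common coset that does not contain `[w]_γ`. -/
def AvoidingLink (E : Set G) (w : G) (γ : Set G) (x y : G) : Prop :=
  ∃ α ⊆ E, y ∈ coset x α ∧ ¬ coset w γ ⊆ coset x α

theorem HWalk.relChain {n : ℕ} (hE : IsCayley E) (hn : 2 ≤ n) (h : CosetAcyclic E n)
    {w u : G} {γ : Set G} (hγ : γ ⊆ E) {k : ℕ} {c : ℕ → Set G × Set G}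
    (hc : HWalk E w γ u k c) : RelChain (AvoidingLink E w γ) (k + 1) w u := by
  obtain ⟨h0, hu, hV, hadj⟩ := hc
  have link : ∀ i ≤ k, ∀ x y, c i ∈ dedge E x → c i ∈ dedge E y → AvoidingLink E w γ x y := by
    intro i hi x y hx hy
    refine ⟨(c i).1, hx.1, ?_, fun hsub => (hV i hi).2 ?_⟩
    · rw [← hx.2, hy.2]
      exact mem_coset_self y _
    · have hxw := coset_eq_of_mem (hsub (mem_coset_self w γ))
      rw [hxw] at hsub
      exact ⟨subset_of_coset_subset hE hn h hx.1 hγ hsub, hx.1, hx.2.trans hxw⟩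
  have main : ∀ j ≤ k, ∀ y, c j ∈ dedge E y → RelChain (AvoidingLink E w γ) (j + 1) w y := by
    intro j
    induction j with
    | zero => exact fun hj y hy => .single (link 0 hj w y h0 hy)
    | succ j ih =>
      intro hj y hy
      obtain ⟨-, z, hz, hz'⟩ := hadj j hj
      exact (ih (by omega) z hz).append (.single (link (j + 1) hj z y hz' hy))
  exact main k le_rfl u hu

/-- A shortest chain of links avoiding `[w]_γ` is a coset path. -/
theorem exists_isNonTPath_of_relChain {w x y : G} {γ : Set G} (hxy : x ≠ y) {k : ℕ}
    (hk : RelChain (AvoidingLink E w γ) k x y)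
    (hmin : ∀ m < k, ¬ RelChain (AvoidingLink E w γ) m x y) :
    ∃ vs α, IsNonTPath E w γ k vs α ∧ vs 1 = x ∧ vs (k + 1) = y := by
  obtain ⟨vs, rfl, rfl, hlink⟩ := hk
  have hex : ∀ i, ∃ α, 1 ≤ i → i ≤ k →
      α ⊆ E ∧ vs (i + 1) ∈ coset (vs i) α ∧ ¬ coset w γ ⊆ coset (vs i) α := by
    intro i
    by_cases hi : 1 ≤ i ∧ i ≤ k
    · obtain ⟨α, hα⟩ := hlink i hi.1 hi.2
      exact ⟨α, fun _ _ => hα⟩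
    · exact ⟨∅, fun h1 h2 => (hi ⟨h1, h2⟩).elim⟩
  choose α hα using hex
  have hk1 : 1 ≤ k := by
    by_contra hk0
    obtain rfl : k = 0 := by omega
    exact hxy rfl
  refine ⟨vs, α, ⟨⟨hk1, fun i h1 h2 => (hα i h1 h2).1, ?_, fun i h1 h2 => (hα i h1 h2).2.1, ?_⟩,
    fun i h1 h2 => (hα i h1 h2).2.2⟩, rfl, rfl⟩
  · intro i j hi hij hj heq
    by_contra hne
    refine hmin _ ?_ ((RelChain.segment hlink le_rfl hi (by omega)).append
      (heq ▸ RelChain.segment hlink (by omega) hj le_rfl))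
    omega
  · intro i hi hik
    refine Set.eq_empty_of_forall_notMem fun z hz => ?_
    have hleft : RelChain (AvoidingLink E w γ) (i - 1) (vs 1) z := by
      rcases Nat.eq_or_lt_of_le hi with rfl | hi'
      · have hz1 : z = vs 1 := by simpa [extLabel, coset_empty] using hz.1
        exact hz1 ▸ .refl _
      · obtain ⟨hsub, hmem, hav⟩ := hα (i - 1) (by omega) (by omega)
        have hzmem : z ∈ coset (vs i) (α (i - 1)) := by
          have := coset_mono _ Set.inter_subset_left hz.1
          rwa [extLabel, if_pos (by omega)] at this
        rw [Nat.sub_add_cancel hi] at hmem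
        have hlast : AvoidingLink E w γ (vs (i - 1)) z :=
          ⟨_, hsub, coset_eq_of_mem hmem ▸ hzmem, hav⟩
        have := (RelChain.segment hlink le_rfl (b := i - 1) (by omega) (by omega)).append
          (.single hlast)
        rwa [Nat.sub_add_cancel (by omega)] at this
    have hright : RelChain (AvoidingLink E w γ) (k - i) z (vs (k + 1)) := by
      rcases Nat.eq_or_lt_of_le hik with rfl | hik'
      · have hz1 : z = vs (i + 1) := by simpa [extLabel, coset_empty] using hz.2
        rw [hz1, Nat.sub_self]
        exact .refl _
      · obtain ⟨hsub, hmem, hav⟩ := hα (i + 1) (by omega) (by omega)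
        have hzmem : z ∈ coset (vs (i + 1)) (α (i + 1)) := by
          have := coset_mono _ Set.inter_subset_right hz.2
          rwa [extLabel, if_pos (by omega)] at this
        rw [coset_eq_of_mem hzmem] at hmem hav
        have hfirst : AvoidingLink E w γ z (vs (i + 2)) := ⟨_, hsub, hmem, hav⟩
        have := (RelChain.single hfirst).append
          (RelChain.segment hlink (a := i + 2) (by omega) (by omega) le_rfl)
        rwa [show 1 + (k + 1 - (i + 2)) = k - i by omega] at this
    exact hmin _ (by omega) (hleft.append hright)

theorem HWalk.exists_isNonTPath {n : ℕ} (hE : IsCayley E) (hn : 2 ≤ n) (h : CosetAcyclic E n)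
    {w u : G} (hwu : w ≠ u) {γ : Set G} (hγ : γ ⊆ E) {k : ℕ} {c : ℕ → Set G × Set G}
    (hc : HWalk E w γ u k c) :
    ∃ m, m ≤ k + 1 ∧ ∃ vs α, IsNonTPath E w γ m vs α ∧ vs 1 = w ∧ vs (m + 1) = u := by
  classical
  have hchain : ∃ m, RelChain (AvoidingLink E w γ) m w u := ⟨_, hc.relChain hE hn h hγ⟩
  exact ⟨Nat.find hchain, Nat.find_min' hchain (hc.relChain hE hn h hγ),
    exists_isNonTPath_of_relChain hwu (Nat.find_spec hchain) fun _ => Nat.find_min hchain⟩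

end Distances

universe u

/-- for every `ℓ ≥ 1` there is `n` such that in every coset `n`-acyclic
Cayley group, for `v ≠ u`, `γ ⊆ E` and `t = ρ(v,γ)`: `d_t(v,u) = ℓ` iff
`d_t(⟦v⟧,⟦u⟧) = ℓ - 1` (both distances expressed as minimality of path lengths). -/
theorem two_distances (ℓ : ℕ) (hℓ : 1 ≤ ℓ) :
    ∃ n : ℕ, ∀ (G : Type u) [Group G] (E : Set G), IsCayley E → CosetAcyclic E n →
      ∀ v u : G, v ≠ u → ∀ γ : Set G, γ ⊆ E →
      (((∃ (vs : ℕ → G) (α : ℕ → Set G),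
            IsNonTPath E v γ ℓ vs α ∧ vs 1 = v ∧ vs (ℓ + 1) = u) ∧
          ∀ k, 1 ≤ k → k < ℓ →
            ¬ ∃ (vs : ℕ → G) (α : ℕ → Set G),
                IsNonTPath E v γ k vs α ∧ vs 1 = v ∧ vs (k + 1) = u) ↔
        ((∃ c : ℕ → Set G × Set G, HWalk E v γ u (ℓ - 1) c) ∧
          ∀ k, k < ℓ - 1 → ¬ ∃ c : ℕ → Set G × Set G, HWalk E v γ u k c)) := by
  refine ⟨2, fun G _ E hE hac v u hvu γ hγ => ?_⟩
  have toWalk : ∀ k, (∃ (vs : ℕ → G) (α : ℕ → Set G),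
      IsNonTPath E v γ k vs α ∧ vs 1 = v ∧ vs (k + 1) = u) → ∃ c, HWalk E v γ u (k - 1) c := by
    rintro k ⟨vs, α, hp, h1, rfl⟩
    exact hp.exists_hWalk h1
  have toPath : ∀ k, (∃ c, HWalk E v γ u k c) → ∃ m, 1 ≤ m ∧ m ≤ k + 1 ∧
      ∃ (vs : ℕ → G) (α : ℕ → Set G), IsNonTPath E v γ m vs α ∧ vs 1 = v ∧ vs (m + 1) = u := by
    rintro k ⟨c, hc⟩
    obtain ⟨m, hm, vs, α, hp⟩ := hc.exists_isNonTPath hE le_rfl hac hvu hγ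
    exact ⟨m, hp.1.1.1, hm, vs, α, hp⟩
  constructor
  · rintro ⟨hp, hmin⟩
    refine ⟨toWalk ℓ hp, fun k hk hc => ?_⟩
    obtain ⟨m, hm1, hm, hpm⟩ := toPath k hc
    exact hmin m hm1 (by omega) hpm
  · rintro ⟨hc, hmin⟩
    have short : ∀ k, 1 ≤ k → k < ℓ → ¬ ∃ (vs : ℕ → G) (α : ℕ → Set G),
        IsNonTPath E v γ k vs α ∧ vs 1 = v ∧ vs (k + 1) = u :=
      fun k hk1 hk hp => hmin (k - 1) (by omega) (toWalk k hp)
    refine ⟨?_, short⟩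
    obtain ⟨m, hm1, hm, hp⟩ := toPath _ hc
    obtain rfl : m = ℓ := by
      by_contra hne
      exact short m hm1 (by omega) hp
    exact hp
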